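/- arXiv:1401.2672 — 7 statements merged into one kernel-verified Lean document; each statement's English description precedes it below -/
import Mathlib

section
/- Let G be a directed graph on vertex set {1,…,n} with neighborhoods N(i) ⊆ {1,…,n}\{i}, and let q be a prime power. If there exists an index code of length ℓ for G over F_q, then there exists an RDSS code C ⊆ F_q^n for G with |C| ≥ q^{n−ℓ}. -/
/-- from an index code of length `ℓ` for `G` over `F_q` one obtains an
RDSS code `C ⊆ F_q^n` for `G` with `|C| ≥ q^(n−ℓ)`. -/
theorem index_to_rdss (n ℓ q : ℕ) (F : Type) [Field F] [Fintype F] [DecidableEq F]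
    (hq : Fintype.card F = q)
    (N : Fin n → Finset (Fin n)) (hN : ∀ i, i ∉ N i)
    (f : (Fin n → F) → (Fin ℓ → F))
    (g : ∀ i : Fin n, (Fin ℓ → F) → ({j // j ∈ N i} → F) → F)
    (hdec : ∀ y : Fin n → F, ∀ i : Fin n, g i (f y) (fun j => y j.1) = y i) :
    ∃ C : Finset (Fin n → F),
      (∀ i : Fin n, ∀ x ∈ C, ∀ y ∈ C, (∀ j ∈ N i, x j = y j) → x i = y i) ∧
      (q : ℝ) ^ ((n : ℤ) - (ℓ : ℤ)) ≤ (C.card : ℝ) := by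
  have hq0 : (q : ℝ) ≠ 0 := by
    rw [← hq]
    exact_mod_cast Fintype.card_ne_zero
  obtain ⟨b, hb⟩ := Fintype.exists_le_card_fiber_of_nsmul_le_card f
    (b := (q : ℝ) ^ ((n : ℤ) - (ℓ : ℤ))) (by
      rw [nsmul_eq_mul, Fintype.card_fun, Fintype.card_fun, hq, Fintype.card_fin,
        Fintype.card_fin]
      push_cast
      rw [← zpow_natCast, ← zpow_natCast, ← zpow_add₀ hq0]
      apply le_of_eq
      congr 1
      ring)
  refine ⟨_, ?_, hb⟩
  intro i x hx y hy hxy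
  simp only [Finset.mem_filter, Finset.mem_univ, true_and] at hx hy
  rw [← hdec x i, ← hdec y i, hx, hy]
  congr 1
  funext j
  exact hxy j.1 j.2
end

section
/- Let G be a directed graph on vertex set {1,…,n} with neighborhoods N(i) ⊆ {1,…,n}\{i}, let q be a prime power, and let C ⊆ F_q^n be a nonempty RDSS code for G. Then there exists an index code for G over F_q with message set {1,…,m}, where m ≤ ⌈(q^n / |C|) · ln |C|⌉ + ⌈q^n / |C|⌉. -/
lemma cover_avg {V : Type*} [AddCommGroup V] [Fintype V] [DecidableEq V] (C U : Finset V) :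
    ∃ v : V, ((U.card : ℝ) * C.card / Fintype.card V) ≤ ((U.filter (fun y => y - v ∈ C)).card : ℝ) := by
  have hs : ∑ v : V, ((U.filter (fun y => y - v ∈ C)).card : ℝ) = (U.card : ℝ) * C.card := by
    have h1 : ∀ v : V, ((U.filter (fun y => y - v ∈ C)).card : ℝ)
        = ∑ y ∈ U, if y - v ∈ C then (1 : ℝ) else 0 := by
      intro v; simp
    simp_rw [h1]
    rw [Finset.sum_comm]
    have h2 : ∀ y ∈ U, (∑ v : V, if y - v ∈ C then (1 : ℝ) else 0) = C.card := by
      intro y _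
      rw [Fintype.sum_equiv (Equiv.subLeft y) (fun v => if y - v ∈ C then (1 : ℝ) else 0)
        (fun w => if w ∈ C then (1 : ℝ) else 0) (by intro x; simp)]
      simp
    rw [Finset.sum_congr rfl h2]
    simp
  have hQ : (Fintype.card V : ℝ) ≠ 0 := by
    exact_mod_cast Fintype.card_ne_zero
  obtain ⟨v, _, hv⟩ := Finset.exists_le_of_sum_le (s := (Finset.univ : Finset V))
    (f := fun _ => (U.card : ℝ) * C.card / Fintype.card V)
    (g := fun v => ((U.filter (fun y => y - v ∈ C)).card : ℝ)) Finset.univ_nonempty (by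
      rw [hs]; simp; field_simp; rfl)
  exact ⟨v, hv⟩

lemma cover_iter {V : Type*} [AddCommGroup V] [Fintype V] [DecidableEq V] (C : Finset V) (t : ℕ) :
    ∃ S : Finset V, S.card ≤ t ∧
      ((Finset.univ.filter (fun y => ∀ v ∈ S, y - v ∉ C)).card : ℝ)
        ≤ Fintype.card V * (1 - (C.card : ℝ) / Fintype.card V) ^ t := by
  induction t with
  | zero => exact ⟨∅, by simp⟩
  | succ t ih =>
    obtain ⟨S, hS, hU⟩ := ih
    set U := Finset.univ.filter (fun y => ∀ v ∈ S, y - v ∉ C) with hUdef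
    obtain ⟨v, hv⟩ := cover_avg C U
    refine ⟨insert v S, (Finset.card_insert_le _ _).trans (by omega), ?_⟩
    have he : Finset.univ.filter (fun y => ∀ w ∈ insert v S, y - w ∉ C)
        = U.filter (fun y => ¬ (y - v ∈ C)) := by
      ext y; simp [hUdef]; tauto
    have hc : ((U.filter (fun y => y - v ∈ C)).card : ℝ)
        + (U.filter (fun y => ¬ (y - v ∈ C))).card = U.card := by
      exact_mod_cast Finset.card_filter_add_card_filter_not (s := U) (fun y => y - v ∈ C)
    have hK : (C.card : ℝ) / Fintype.card V ≤ 1 := by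
      apply div_le_one_of_le₀
      · exact_mod_cast Finset.card_le_univ C
      · positivity
    rw [he, pow_succ, ← mul_assoc]
    have h3 := mul_le_mul_of_nonneg_right hU (sub_nonneg.2 hK)
    have h4 : (U.card : ℝ) * C.card / Fintype.card V
      = U.card * ((C.card : ℝ) / Fintype.card V) := by ring
    linarith

lemma cover_exists {V : Type*} [AddCommGroup V] [Fintype V] [DecidableEq V] (C : Finset V)
    (hC : C.Nonempty) :
    ∃ S : Finset V, S.card ≤ ⌈((Fintype.card V : ℝ) / C.card) * Real.log C.card⌉₊
        + ⌈(Fintype.card V : ℝ) / C.card⌉₊ ∧ ∀ y, ∃ v ∈ S, y - v ∈ C := by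
  set t := ⌈((Fintype.card V : ℝ) / C.card) * Real.log C.card⌉₊ with ht
  obtain ⟨S, hS, hU⟩ := cover_iter C t
  set U := Finset.univ.filter (fun y => ∀ v ∈ S, y - v ∉ C) with hUdef
  obtain ⟨c, hc⟩ := hC
  have hK : (0 : ℝ) < C.card := by exact_mod_cast Finset.card_pos.2 ⟨c, hc⟩
  have hQ : (0 : ℝ) < Fintype.card V := by exact_mod_cast Fintype.card_pos
  have hKQ : (C.card : ℝ) / Fintype.card V ≤ 1 := by
    apply div_le_one_of_le₀
    · exact_mod_cast Finset.card_le_univ C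
    · positivity
  have hpow : (1 - (C.card : ℝ) / Fintype.card V) ^ t ≤ 1 / C.card := by
    calc (1 - (C.card : ℝ) / Fintype.card V) ^ t
        ≤ (Real.exp (-((C.card : ℝ) / Fintype.card V))) ^ t :=
          pow_le_pow_left₀ (sub_nonneg.2 hKQ) (Real.one_sub_le_exp_neg _) _
      _ = Real.exp (-(t * ((C.card : ℝ) / Fintype.card V))) := by
          rw [← Real.exp_nat_mul]; ring_nf
      _ ≤ Real.exp (-Real.log C.card) := by
          apply Real.exp_le_exp.2
          have h := Nat.le_ceil (((Fintype.card V : ℝ) / C.card) * Real.log C.card)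
          rw [← ht] at h
          have h2 := mul_le_mul_of_nonneg_right h
            (show (0 : ℝ) ≤ (C.card : ℝ) / Fintype.card V by positivity)
          have h3 : ((Fintype.card V : ℝ) / C.card) * Real.log C.card
            * ((C.card : ℝ) / Fintype.card V) = Real.log C.card := by field_simp
          linarith
      _ = 1 / C.card := by rw [Real.exp_neg, Real.exp_log hK, one_div]
  have hUc : U.card ≤ ⌈(Fintype.card V : ℝ) / C.card⌉₊ := by
    have h : (U.card : ℝ) ≤ (Fintype.card V : ℝ) / C.card := by
      refine hU.trans ((mul_le_mul_of_nonneg_left hpow hQ.le).trans (le_of_eq ?_))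
      ring
    exact_mod_cast h.trans (Nat.le_ceil _)
  refine ⟨S ∪ U.image (fun y => y - c), ?_, ?_⟩
  · exact (Finset.card_union_le _ _).trans
      (add_le_add hS (Finset.card_image_le.trans hUc))
  · intro y
    by_cases hy : y ∈ U
    · exact ⟨y - c, Finset.mem_union_right _ (Finset.mem_image_of_mem _ hy), by simpa using hc⟩
    · simp only [hUdef, Finset.mem_filter, Finset.mem_univ, true_and, not_forall,
        not_not] at hy
      obtain ⟨v, hv, h⟩ := hy
      exact ⟨v, Finset.mem_union_left _ hv, h⟩


/-- from a nonempty RDSS code `C` for `G` one obtains an index code for `G`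
with message set `{1,…,m}` where `m ≤ ⌈(q^n/|C|)·ln|C|⌉ + ⌈q^n/|C|⌉`. -/
theorem rdss_to_index_k_bound (n q : ℕ) (F : Type) [Field F] [Fintype F] [DecidableEq F]
    (hq : Fintype.card F = q)
    (N : Fin n → Finset (Fin n)) (hN : ∀ i, i ∉ N i)
    (C : Finset (Fin n → F)) (hC : C.Nonempty)
    (hRDSS : ∀ i : Fin n, ∀ x ∈ C, ∀ y ∈ C, (∀ j ∈ N i, x j = y j) → x i = y i) :
    ∃ (m : ℕ) (f : (Fin n → F) → Fin m)
      (g : ∀ i : Fin n, Fin m → ({j // j ∈ N i} → F) → F),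
      m ≤ ⌈((q : ℝ) ^ n / (C.card : ℝ)) * Real.log (C.card : ℝ)⌉₊ +
          ⌈(q : ℝ) ^ n / (C.card : ℝ)⌉₊ ∧
      ∀ y : Fin n → F, ∀ i : Fin n, g i (f y) (fun j => y j.1) = y i := by

  classical
  obtain ⟨S, hS, hcov⟩ := cover_exists C hC
  have hcard : (Fintype.card (Fin n → F) : ℝ) = (q : ℝ) ^ n := by
    simp [hq]
  rw [hcard] at hS
  choose v hvS hvC using hcov
  let e := S.equivFin
  let f : (Fin n → F) → Fin S.card := fun y => e ⟨v y, hvS y⟩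
  refine ⟨S.card, f, fun i k z =>
    if h : ∃ x : Fin n → F, f x = k ∧ (fun j : {j // j ∈ N i} => x j.1) = z
    then h.choose i else 0, hS, ?_⟩
  intro y i
  have h : ∃ x : Fin n → F, f x = f y ∧
      (fun j : {j // j ∈ N i} => x j.1) = (fun j : {j // j ∈ N i} => y j.1) := ⟨y, rfl, rfl⟩
  simp only [dif_pos h]
  obtain ⟨h1, h2⟩ := h.choose_spec
  generalize h.choose = x at h1 h2
  have hv : v x = v y := by
    have := e.injective h1
    simpa using this
  have h3 := hRDSS i (x - v x) (hvC x) (y - v y) (hvC y) (by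
    intro j hj
    have := congrFun h2 ⟨j, hj⟩
    simp only at this
    simp [hv, this])
  simpa [hv] using h3
end

section
/- Let q be a prime power, n ≥ 1, and F ⊆ F_q^n. Then there exists a vector x ∈ F_q^n such that q^n − |F ∪ (F + x)| ≤ (q^n − |F|)^2 / q^n, i.e., Q(F ∪ (F + x)) ≤ Q(F)^2 where Q(S) = 1 − |S|/q^n. -/
lemma sum_uncovered {G : Type} [AddCommGroup G] [Fintype G] [DecidableEq G] (S : Finset G) :
    ∑ x : G, ((S ∪ S.image (fun y => y + x))ᶜ).card = Sᶜ.card ^ 2 := by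
  have h1 : ∀ x : G, ((S ∪ S.image (fun y => y + x))ᶜ).card
      = ∑ z ∈ Sᶜ, if z - x ∈ Sᶜ then 1 else 0 := by
    intro x
    rw [← Finset.card_filter]
    congr 1
    ext z
    simp only [Finset.mem_compl, Finset.mem_union, Finset.mem_image, Finset.mem_filter, not_or]
    refine and_congr_right fun _ => not_congr ⟨?_, fun h => ⟨z - x, h, by simp⟩⟩
    rintro ⟨y, hy, rfl⟩
    simpa using hy
  simp_rw [h1]
  rw [Finset.sum_comm]
  have h2 : ∀ z : G, (∑ x : G, if z - x ∈ Sᶜ then 1 else 0) = Sᶜ.card := by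
    intro z
    refine ((Equiv.subLeft z).sum_comp (fun w => if w ∈ Sᶜ then 1 else 0)).trans ?_
    rw [← Finset.card_filter]
    congr 1
    ext; simp
  simp_rw [h2]
  simp [sq]

/-- there is a translate whose union with `F` leaves at most
`(q^n − |F|)^2 / q^n` points uncovered. -/
theorem exists_good_translate (n q : ℕ) (hn : 1 ≤ n) (K : Type) [Field K] [Fintype K]
    [DecidableEq K] (hq : Fintype.card K = q)
    (S : Finset (Fin n → K)) :
    ∃ x : Fin n → K,
      (q : ℝ) ^ n - ((S ∪ S.image (fun y => y + x)).card : ℝ) ≤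
        ((q : ℝ) ^ n - (S.card : ℝ)) ^ 2 / (q : ℝ) ^ n := by
  have hc : Fintype.card (Fin n → K) = q ^ n := by simp [hq]
  have hqpos : (0 : ℝ) < (q : ℝ) ^ n := by
    have : 0 < q := hq ▸ Fintype.card_pos
    positivity
  have hT : ∀ T : Finset (Fin n → K), ((Tᶜ).card : ℝ) = (q : ℝ) ^ n - T.card := by
    intro T
    have := Finset.card_add_card_compl T
    rw [hc] at this
    have h : (T.card : ℝ) + (Tᶜ).card = (q : ℝ) ^ n := by exact_mod_cast this
    linarith
  have hs : ∑ x : Fin n → K, (((S ∪ S.image (fun y => y + x))ᶜ).card : ℝ)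
      = (Sᶜ.card : ℝ) ^ 2 := by exact_mod_cast sum_uncovered S
  simp_rw [hT] at hs
  obtain ⟨x, -, hx⟩ := Finset.exists_le_of_sum_le (s := (Finset.univ : Finset (Fin n → K)))
    (f := fun x => (q : ℝ) ^ n - ((S ∪ S.image (fun y => y + x)).card : ℝ))
    (g := fun _ => ((q : ℝ) ^ n - (S.card : ℝ)) ^ 2 / (q : ℝ) ^ n)
    Finset.univ_nonempty (by
      rw [hs, Finset.sum_const, Finset.card_univ, hc, nsmul_eq_mul]
      push_cast
      rw [mul_div_cancel₀ _ hqpos.ne'])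
  exact ⟨x, hx⟩
end

section
/- Let q be a prime power, n ≥ 1, F ⊆ F_q^n, and t ≥ 0 an integer. Then there exists a set S ⊆ F_q^n with 0 ∈ S and |S| ≤ 2^t such that the union ∪_{x ∈ S} (F + x) misses at most q^n · (1 − |F|/q^n)^{2^t} points of F_q^n, i.e., q^n − |∪_{x ∈ S}(F + x)| ≤ q^n (1 − |F|/q^n)^{2^t}. -/
theorem greedy_step {G : Type*} [AddCommGroup G] [Fintype G] [DecidableEq G]
    (F U : Finset G) : ∃ x : G, (F.card : ℝ) * ((Fintype.card G : ℝ) - U.card) ≤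
      (Fintype.card G : ℝ) * ((F.image (fun y => y + x)) \ U).card := by
  have key : ∑ x : G, ((((F.image (fun y => y + x)) \ U).card : ℕ) : ℝ)
      = (F.card : ℝ) * ((Fintype.card G : ℝ) - U.card) := by
    have h1 : ∀ x : G, ((F.image (fun y => y + x)) \ U).card
        = ∑ y ∈ F, if y + x ∈ U then 0 else 1 := by
      intro x
      have : (F.image (fun y => y + x)) \ U
          = (F.filter (fun y => y + x ∉ U)).image (fun y => y + x) := by
        ext z
        simp only [Finset.mem_sdiff, Finset.mem_image, Finset.mem_filter]
        constructor
        · rintro ⟨⟨y, hy, rfl⟩, h⟩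
          exact ⟨y, ⟨hy, h⟩, rfl⟩
        · rintro ⟨y, ⟨hy, h⟩, rfl⟩
          exact ⟨⟨y, hy, rfl⟩, h⟩
      rw [this, Finset.card_image_of_injective _ (add_left_injective x), Finset.card_filter]
      refine Finset.sum_congr rfl fun y _ => ?_
      by_cases h : y + x ∈ U <;> simp [h]
    have h2 : ∀ y : G, (∑ x : G, if y + x ∈ U then 0 else 1) = Uᶜ.card := by
      intro y
      refine (Equiv.sum_comp (Equiv.addLeft y) (fun z => if z ∈ U then 0 else 1)).trans ?_
      have hU : Uᶜ = Finset.univ.filter (fun z => z ∉ U) := by ext z; simp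
      rw [hU, Finset.card_filter]
      refine Finset.sum_congr rfl fun z _ => ?_
      by_cases h : z ∈ U <;> simp [h]
    have h3 : ∑ x : G, ((F.image (fun y => y + x)) \ U).card = F.card * Uᶜ.card := by
      simp_rw [h1]
      rw [Finset.sum_comm]
      simp_rw [h2]
      simp
    have h4 : (Uᶜ.card : ℝ) = (Fintype.card G : ℝ) - U.card := by
      rw [← Finset.card_add_card_compl U]; push_cast; ring
    rw [← h4]
    exact_mod_cast h3
  by_contra! h
  have h5 := Finset.sum_lt_sum_of_nonempty (s := (Finset.univ : Finset G)) ⟨0, Finset.mem_univ 0⟩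
    (fun x _ => h x)
  rw [← Finset.mul_sum, key] at h5
  simp at h5

theorem greedy_iter {G : Type*} [AddCommGroup G] [Fintype G] [DecidableEq G]
    (F : Finset G) (k : ℕ) : ∃ S : Finset G, (0 : G) ∈ S ∧ S.card ≤ k + 1 ∧
      (Fintype.card G : ℝ) - ((S.biUnion (fun x => F.image (fun y => y + x))).card : ℝ) ≤
        (Fintype.card G : ℝ) * (1 - (F.card : ℝ) / (Fintype.card G : ℝ)) ^ (k + 1) := by
  have hN : (0 : ℝ) < Fintype.card G := by exact_mod_cast Fintype.card_pos
  have hF : (F.card : ℝ) ≤ Fintype.card G := by exact_mod_cast Finset.card_le_univ F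
  have hp : 0 ≤ 1 - (F.card : ℝ) / (Fintype.card G : ℝ) := by
    rw [sub_nonneg, div_le_one hN]; exact hF
  induction k with
  | zero =>
    refine ⟨{0}, by simp, by simp, ?_⟩
    simp only [Finset.singleton_biUnion, add_zero, Finset.image_id', zero_add, pow_one]
    apply le_of_eq
    field_simp
  | succ k ih =>
    obtain ⟨S, h0, hc, h⟩ := ih
    set U := S.biUnion (fun x => F.image (fun y => y + x)) with hU
    obtain ⟨x, hx⟩ := greedy_step F U
    refine ⟨insert x S, Finset.mem_insert_of_mem h0,
      (Finset.card_insert_le _ _).trans (by omega), ?_⟩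
    rw [Finset.biUnion_insert, ← hU, ← Finset.sdiff_union_self_eq_union,
      Finset.card_union_of_disjoint Finset.sdiff_disjoint]
    have h6 := mul_le_mul_of_nonneg_right h hp
    rw [mul_assoc, ← pow_succ] at h6
    refine le_trans ?_ h6
    have h7 : (F.card : ℝ) / (Fintype.card G : ℝ) * ((Fintype.card G : ℝ) - U.card) ≤
      ((F.image (fun y => y + x)) \ U).card := by
      rw [div_mul_eq_mul_div, div_le_iff₀ hN]; linarith
    push_cast
    linarith


/-- for any `t ≥ 0` there is a set `S` of at most `2^t` shifts containing `0`
whose translates of `F` miss at most `q^n (1 − |F|/q^n)^{2^t}` points. -/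
theorem greedy_covering_iterate (n q : ℕ) (hn : 1 ≤ n) (K : Type) [Field K] [Fintype K]
    [DecidableEq K] (hq : Fintype.card K = q)
    (F : Finset (Fin n → K)) (t : ℕ) :
    ∃ S : Finset (Fin n → K), (0 : Fin n → K) ∈ S ∧ S.card ≤ 2 ^ t ∧
      (q : ℝ) ^ n - ((S.biUnion (fun x => F.image (fun y => y + x))).card : ℝ) ≤
        (q : ℝ) ^ n * (1 - (F.card : ℝ) / (q : ℝ) ^ n) ^ (2 ^ t) := by
  obtain ⟨S, h0, hc, h⟩ := greedy_iter F (2 ^ t - 1)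
  have ht : 2 ^ t - 1 + 1 = 2 ^ t := Nat.sub_add_cancel Nat.one_le_two_pow
  have hcard : (Fintype.card (Fin n → K) : ℝ) = (q : ℝ) ^ n := by
    rw [Fintype.card_fun, hq, Fintype.card_fin]; push_cast; rfl
  rw [ht] at hc h
  rw [hcard] at h
  refine ⟨S, h0, hc, ?_⟩
  convert h
end

section
/- Let q be a prime power, n ≥ 1, and let F ⊆ F_q^n be nonempty. Then there exist m vectors x_0 = 0, x_1, …, x_{m−1} ∈ F_q^n with m ≤ ⌈(q^n / |F|) · min{ n·ln q , 1 + ln |F| }⌉ such that ∪_{i=0}^{m−1} (F + x_i) = F_q^n. -/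
open Finset in
theorem avg_step {G : Type} [AddCommGroup G] [Fintype G] [DecidableEq G] (F U : Finset G) :
    ∃ x : G, (U.card : ℝ) * F.card ≤ (Fintype.card G : ℝ) * (U.filter (fun u => u - x ∈ F)).card := by
  by_contra! h
  have h1 : ∑ x : G, (Fintype.card G : ℝ) * ((U.filter (fun u => u - x ∈ F)).card : ℝ)
      < ∑ _x : G, (U.card : ℝ) * F.card :=
    Finset.sum_lt_sum_of_nonempty ⟨0, mem_univ _⟩ (fun x _ => h x)
  have h2 : ∑ x : G, (U.filter (fun u => u - x ∈ F)).card = U.card * F.card := by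
    simp_rw [Finset.card_filter]
    rw [Finset.sum_comm]
    rw [Finset.sum_const_nat (m := F.card)]
    intro u _
    rw [← Finset.card_filter]
    apply Finset.card_bij' (fun x _ => u - x) (fun y _ => u - y) <;> simp
  rw [← Finset.mul_sum, ← Nat.cast_sum, h2] at h1
  simp at h1

open Finset in
theorem greedy {G : Type} [AddCommGroup G] [Fintype G] [DecidableEq G] (F : Finset G) (t : ℕ) :
    ∃ S : Finset G, S.card ≤ t ∧
      ((univ.filter (fun u => ∀ x ∈ S, u - x ∉ F)).card : ℝ)
        ≤ Fintype.card G * (1 - F.card / Fintype.card G : ℝ) ^ t := by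
  have hN : (0 : ℝ) < Fintype.card G := by
    exact_mod_cast Fintype.card_pos_iff.mpr ⟨0⟩
  have hr : (0 : ℝ) ≤ 1 - F.card / Fintype.card G := by
    rw [sub_nonneg, div_le_one hN]
    exact_mod_cast Finset.card_le_univ F
  induction t with
  | zero => exact ⟨∅, by simp, by simp⟩
  | succ t ih =>
    obtain ⟨S, hS, hU⟩ := ih
    set U := univ.filter (fun u => ∀ x ∈ S, u - x ∉ F) with hUd
    obtain ⟨x, hx⟩ := avg_step F U
    refine ⟨insert x S, (card_insert_le _ _).trans (by omega), ?_⟩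
    have e : univ.filter (fun u => ∀ y ∈ insert x S, u - y ∉ F)
        = U.filter (fun u => ¬ (u - x ∈ F)) := by
      ext u; simp [hUd, and_comm]
    rw [e]
    have hc : ((U.filter (fun u => u - x ∈ F)).card : ℝ)
        + (U.filter (fun u => ¬ (u - x ∈ F))).card = U.card := by
      exact_mod_cast Finset.card_filter_add_card_filter_not (s := U) (fun u => u - x ∈ F)
    have h3 : (U.card : ℝ) * (F.card / Fintype.card G) ≤ (U.filter (fun u => u - x ∈ F)).card := by
      rw [← mul_div_assoc, div_le_iff₀ hN]; linarith
    have h4 := mul_le_mul_of_nonneg_right hU hr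
    rw [pow_succ]
    nlinarith

open Finset in
theorem cover_group {G : Type} [AddCommGroup G] [Fintype G] [DecidableEq G] [Nontrivial G]
    (F : Finset G) (hF : F.Nonempty) (m : ℕ)
    (hm : m = ⌈((Fintype.card G : ℝ) / F.card) * Real.log (Fintype.card G)⌉₊ ∨
      m = ⌈((Fintype.card G : ℝ) / F.card) * (1 + Real.log F.card)⌉₊) :
    ∃ S : Finset G, S.card ≤ m ∧ ∀ u, ∃ x ∈ S, u - x ∈ F := by
  have hN : (0 : ℝ) < Fintype.card G := by
    exact_mod_cast Fintype.card_pos_iff.mpr ⟨0⟩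
  have hN1 : (1 : ℝ) < Fintype.card G := by
    exact_mod_cast Fintype.one_lt_card
  have hf : (0 : ℝ) < F.card := by exact_mod_cast hF.card_pos
  have hf1 : (1 : ℝ) ≤ F.card := by exact_mod_cast hF.card_pos
  have hr : (0 : ℝ) ≤ 1 - F.card / Fintype.card G := by
    rw [sub_nonneg, div_le_one hN]
    exact_mod_cast Finset.card_le_univ F
  have hq : (0 : ℝ) < F.card / Fintype.card G := by positivity
  have hlt : 1 - F.card / Fintype.card G < Real.exp (-(F.card / Fintype.card G : ℝ)) := by
    have := Real.add_one_lt_exp (x := -(F.card / Fintype.card G : ℝ)) (by linarith)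
    linarith
  rcases hm with rfl | rfl
  · set t := ⌈((Fintype.card G : ℝ) / F.card) * Real.log (Fintype.card G)⌉₊ with ht
    obtain ⟨S, hS, hU⟩ := greedy F t
    refine ⟨S, hS, ?_⟩
    have hlog : 0 < Real.log (Fintype.card G) := Real.log_pos hN1
    have ht0 : t ≠ 0 := by
      rw [ht]; exact (Nat.ceil_pos.mpr (by positivity)).ne'
    have htl : ((Fintype.card G : ℝ) / F.card) * Real.log (Fintype.card G) ≤ t := Nat.le_ceil _
    have h1 := pow_lt_pow_left₀ hlt hr ht0
    rw [← Real.exp_nat_mul] at h1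
    have h2 : (t : ℝ) * -(F.card / Fintype.card G : ℝ) ≤ - Real.log (Fintype.card G) := by
      have := mul_le_mul_of_nonneg_right htl hq.le
      have e : ((Fintype.card G : ℝ) / F.card) * Real.log (Fintype.card G) * (F.card / Fintype.card G)
        = Real.log (Fintype.card G) := by field_simp
      linarith
    have h3 := Real.exp_le_exp.mpr h2
    rw [Real.exp_neg, Real.exp_log hN] at h3
    have h4 := mul_lt_mul_of_pos_left (h1.trans_le h3) hN
    rw [mul_inv_cancel₀ hN.ne'] at h4
    have h5 := hU.trans_lt h4
    have h6 : (univ.filter (fun u => ∀ x ∈ S, u - x ∉ F)).card = 0 := by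
      have : (univ.filter (fun u => ∀ x ∈ S, u - x ∉ F)).card < 1 := by exact_mod_cast h5
      omega
    rw [Finset.card_eq_zero, Finset.filter_eq_empty_iff] at h6
    intro u
    have := h6 (mem_univ u)
    push Not at this
    exact this
  · set t := ⌈((Fintype.card G : ℝ) / F.card) * Real.log F.card⌉₊ with ht
    obtain ⟨S, hS, hU⟩ := greedy F t
    have hlog : 0 ≤ Real.log F.card := Real.log_nonneg hf1
    have htl : ((Fintype.card G : ℝ) / F.card) * Real.log F.card ≤ t := Nat.le_ceil _
    have htu : (t : ℝ) < ((Fintype.card G : ℝ) / F.card) * Real.log F.card + 1 :=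
      Nat.ceil_lt_add_one (by positivity)
    have h1 := pow_le_pow_left₀ hr hlt.le t
    rw [← Real.exp_nat_mul] at h1
    have h2 : (t : ℝ) * -(F.card / Fintype.card G : ℝ) ≤ - Real.log F.card := by
      have := mul_le_mul_of_nonneg_right htl hq.le
      have e : ((Fintype.card G : ℝ) / F.card) * Real.log F.card * (F.card / Fintype.card G)
        = Real.log F.card := by field_simp
      linarith
    have h3 := Real.exp_le_exp.mpr h2
    rw [Real.exp_neg, Real.exp_log hf] at h3
    have h4 := mul_le_mul_of_nonneg_left (h1.trans h3) hN.le
    have h5 := hU.trans h4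
    obtain ⟨y, hy⟩ := hF
    set U := univ.filter (fun u => ∀ x ∈ S, u - x ∉ F) with hUd
    refine ⟨S ∪ U.image (fun u => u - y), ?_, ?_⟩
    · have c1 : (S ∪ U.image (fun u => u - y)).card ≤ t + U.card :=
        (card_union_le _ _).trans (add_le_add hS card_image_le)
      refine c1.trans ?_
      have c2 := Nat.le_ceil (((Fintype.card G : ℝ) / F.card) * (1 + Real.log F.card))
      rw [← div_eq_mul_inv] at h5
      have c3 : ((t + U.card : ℕ) : ℝ) <
          ((⌈((Fintype.card G : ℝ) / F.card) * (1 + Real.log F.card)⌉₊ + 1 : ℕ) : ℝ) := by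
        push_cast
        linarith
      have := Nat.cast_lt.mp c3
      omega
    · intro u
      by_cases hu : u ∈ U
      · exact ⟨u - y, mem_union_right _ (mem_image_of_mem _ hu), by simpa using hy⟩
      · simp only [hUd, mem_filter, mem_univ, true_and] at hu
        push Not at hu
        obtain ⟨x, hx, h⟩ := hu
        exact ⟨x, mem_union_left _ hx, h⟩


/-- a nonempty `F ⊆ F_q^n` has a covering by
`m ≤ ⌈(q^n/|F|)·min{n ln q, 1 + ln |F|}⌉` translates, one of which is by the zero vector. -/
theorem covering_by_translates (n q : ℕ) (hn : 1 ≤ n) (K : Type) [Field K] [Fintype K]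
    [DecidableEq K] (hq : Fintype.card K = q)
    (F : Finset (Fin n → K)) (hF : F.Nonempty) :
    ∃ S : Finset (Fin n → K), (0 : Fin n → K) ∈ S ∧
      S.card ≤ ⌈((q : ℝ) ^ n / (F.card : ℝ)) *
          min ((n : ℝ) * Real.log q) (1 + Real.log (F.card : ℝ))⌉₊ ∧
      S.biUnion (fun x => F.image (fun y => y + x)) = Finset.univ := by
  haveI : Nonempty (Fin n) := ⟨⟨0, hn⟩⟩
  have hcard : ((Fintype.card (Fin n → K) : ℕ) : ℝ) = (q : ℝ) ^ n := by
    simp [hq]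
  have hl : Real.log ((q : ℝ) ^ n) = n * Real.log q := Real.log_pow _ _
  obtain ⟨S, hS, hc⟩ := cover_group F hF
    ⌈((q : ℝ) ^ n / (F.card : ℝ)) *
          min ((n : ℝ) * Real.log q) (1 + Real.log (F.card : ℝ))⌉₊ (by
      rw [hcard, hl]
      rcases min_choice ((n : ℝ) * Real.log q) (1 + Real.log (F.card : ℝ)) with h | h
      · left; rw [h]
      · right; rw [h])
  obtain ⟨s, hs, -⟩ := hc 0
  refine ⟨S.image (fun x => x - s), ?_, Finset.card_image_le.trans hS, ?_⟩
  · exact Finset.mem_image.mpr ⟨s, hs, sub_self s⟩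
  · ext u
    simp only [Finset.mem_biUnion, Finset.mem_image, Finset.mem_univ, iff_true]
    obtain ⟨x, hx, h⟩ := hc (u + s)
    exact ⟨x - s, ⟨x, hx, rfl⟩, u + s - x, h, by abel⟩
end

section
/- Let G be a directed graph on vertex set {1,…,n} with neighborhoods N(i) ⊆ {1,…,n}\{i}, let q be a prime power, and let A be an n×n matrix over F_q that fits G, i.e., A_{ii} ≠ 0 for every i and A_{ij} = 0 whenever i ≠ j and j ∉ N(i). Then the null space { x ∈ F_q^n : A x = 0 } is an RDSS code for G of size q^{n − rank(A)}. Consequently, there exists an RDSS code for G of size at least q^{n − minrank_q(G)}, where minrank_q(G) is the minimum rank over F_q of all matrices fitting G. -/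
theorem nullspace_aux_rdss {n : ℕ} {F : Type} [Field F]
    (N : Fin n → Finset (Fin n)) (A : Matrix (Fin n) (Fin n) F)
    (hAdiag : ∀ i, A i i ≠ 0)
    (hAfit : ∀ i j, i ≠ j → j ∉ N i → A i j = 0)
    (i : Fin n) (x y : Fin n → F) (hx : A.mulVec x = 0) (hy : A.mulVec y = 0)
    (h : ∀ j ∈ N i, x j = y j) : x i = y i := by
  have hz : A.mulVec (x - y) = 0 := by rw [Matrix.mulVec_sub, hx, hy, sub_zero]
  have h1 : ∑ j, A i j * (x - y) j = 0 := congrFun hz i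
  rw [Finset.sum_eq_single i] at h1
  · rcases mul_eq_zero.mp h1 with h2 | h2
    · exact absurd h2 (hAdiag i)
    · exact sub_eq_zero.mp h2
  · intro j _ hj
    by_cases hjN : j ∈ N i
    · simp [h j hjN]
    · simp [hAfit i j (Ne.symm hj) hjN]
  · simp

theorem nullspace_aux_card {n : ℕ} {F : Type} [Field F] [Fintype F]
    (A : Matrix (Fin n) (Fin n) F) :
    Nat.card {x : Fin n → F | A.mulVec x = 0} = Fintype.card F ^ (n - A.rank) := by
  have h1 := LinearMap.finrank_range_add_finrank_ker A.mulVecLin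
  have h2 : Module.finrank F (LinearMap.ker A.mulVecLin) = n - A.rank := by
    rw [Module.finrank_fin_fun] at h1
    unfold Matrix.rank
    omega
  have h3 := Module.natCard_eq_pow_finrank (K := F) (V := LinearMap.ker A.mulVecLin)
  rw [h2, Nat.card_eq_fintype_card (α := F)] at h3
  rw [← h3]
  rfl

/-- the null space of a matrix fitting `G` is an RDSS code for `G` of size
`q^{n − rank A}`; consequently there is an RDSS code of size at least `q^{n − minrank_q(G)}`. -/
theorem nullspace_is_rdss (n q : ℕ) (F : Type) [Field F] [Fintype F] [DecidableEq F]
    (hq : Fintype.card F = q)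
    (N : Fin n → Finset (Fin n)) (hN : ∀ i, i ∉ N i)
    (A : Matrix (Fin n) (Fin n) F)
    (hAdiag : ∀ i, A i i ≠ 0)
    (hAfit : ∀ i j, i ≠ j → j ∉ N i → A i j = 0) :
    ((∀ i : Fin n, ∀ x ∈ {x : Fin n → F | A.mulVec x = 0},
        ∀ y ∈ {x : Fin n → F | A.mulVec x = 0},
          (∀ j ∈ N i, x j = y j) → x i = y i) ∧
      Nat.card {x : Fin n → F | A.mulVec x = 0} = q ^ (n - A.rank)) ∧
    ∃ C : Finset (Fin n → F),
      (∀ i : Fin n, ∀ x ∈ C, ∀ y ∈ C, (∀ j ∈ N i, x j = y j) → x i = y i) ∧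
      q ^ (n - sInf {r : ℕ | ∃ B : Matrix (Fin n) (Fin n) F,
            (∀ i, B i i ≠ 0) ∧ (∀ i j, i ≠ j → j ∉ N i → B i j = 0) ∧ B.rank = r}) ≤
        C.card := by
  classical
  subst hq
  refine ⟨⟨fun i x hx y hy h => nullspace_aux_rdss N A hAdiag hAfit i x y hx hy h,
    nullspace_aux_card A⟩, ?_⟩
  obtain ⟨B, hB1, hB2, hB3⟩ := Nat.sInf_mem (s := {r : ℕ | ∃ B : Matrix (Fin n) (Fin n) F,
    (∀ i, B i i ≠ 0) ∧ (∀ i j, i ≠ j → j ∉ N i → B i j = 0) ∧ B.rank = r})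
    ⟨A.rank, A, hAdiag, hAfit, rfl⟩
  refine ⟨Finset.univ.filter (fun x => B.mulVec x = 0), ?_, ?_⟩
  · intro i x hx y hy h
    exact nullspace_aux_rdss N B hB1 hB2 i x y (by simpa using hx) (by simpa using hy) h
  · rw [← hB3, ← nullspace_aux_card B, Nat.card_eq_fintype_card]
    exact (Fintype.card_subtype _).le
end

section
/- Let G be a directed graph on vertex set {1,…,n} with neighborhoods N(i) ⊆ {1,…,n}\{i}, let q be a prime power, and let C ⊆ F_q^n be an RDSS code for G whose recovery functions are all F_q-linear; that is, for each i there exist coefficients α_{ij} ∈ F_q (j ∈ N(i)) such that every codeword x ∈ C satisfies x_i = Σ_{j ∈ N(i)} α_{ij} x_j. Then |C| ≤ q^{n − minrank_q(G)}, where minrank_q(G) is the minimum rank over F_q of all n×n matrices A with A_{ii} ≠ 0 for all i and A_{ij} = 0 whenever i ≠ j and j ∉ N(i). -/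
/-- an RDSS code whose recovery functions are all linear has size at most
`q^{n − minrank_q(G)}`. -/
theorem linear_rdss_le_minrank (n q : ℕ) (F : Type) [Field F] [Fintype F] [DecidableEq F]
    (hq : Fintype.card F = q)
    (N : Fin n → Finset (Fin n)) (hN : ∀ i, i ∉ N i)
    (C : Finset (Fin n → F))
    (α : Fin n → Fin n → F)
    (hα : ∀ i j, j ∉ N i → α i j = 0)
    (hlin : ∀ x ∈ C, ∀ i : Fin n, x i = ∑ j ∈ N i, α i j * x j) :
    C.card ≤ q ^ (n - sInf {r : ℕ | ∃ B : Matrix (Fin n) (Fin n) F,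
        (∀ i, B i i ≠ 0) ∧ (∀ i j, i ≠ j → j ∉ N i → B i j = 0) ∧ B.rank = r}) := by
  classical
  set A : Matrix (Fin n) (Fin n) F := 1 - Matrix.of α with hA
  have hle : sInf {r : ℕ | ∃ B : Matrix (Fin n) (Fin n) F,
        (∀ i, B i i ≠ 0) ∧ (∀ i j, i ≠ j → j ∉ N i → B i j = 0) ∧ B.rank = r} ≤ A.rank := by
    apply Nat.sInf_le
    refine ⟨A, ?_, ?_, rfl⟩
    · intro i
      simp [hA, hα i i (hN i)]
    · intro i j hij hj
      simp [hA, hα i j hj, Matrix.one_apply_ne hij]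
  have hker : ∀ x ∈ C, x ∈ LinearMap.ker A.mulVecLin := by
    intro x hx
    rw [LinearMap.mem_ker, Matrix.mulVecLin_apply, hA, Matrix.sub_mulVec, Matrix.one_mulVec,
      sub_eq_zero]
    funext i
    rw [hlin x hx i]
    simp only [Matrix.mulVec, dotProduct, Matrix.of_apply]
    apply Finset.sum_subset (Finset.subset_univ _)
    intro j _ hj
    simp [hα i j hj]
  have hrn : A.rank + Module.finrank F (LinearMap.ker A.mulVecLin) = n := by
    have h := LinearMap.finrank_range_add_finrank_ker A.mulVecLin
    simpa [Matrix.rank] using h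
  have hcard : C.card ≤ q ^ Module.finrank F (LinearMap.ker A.mulVecLin) := by
    rw [← hq, ← Module.card_eq_pow_finrank (K := F) (V := LinearMap.ker A.mulVecLin),
      ← Fintype.card_coe C]
    exact Fintype.card_le_of_injective (fun x => ⟨x.1, hker x.1 x.2⟩) (by
      intro x y h
      exact Subtype.ext (congrArg (fun z => z.1) h))
  refine hcard.trans (Nat.pow_le_pow_right ?_ (by omega))
  rw [← hq]
  exact Fintype.card_pos
end
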